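/- arXiv:2412.13075 — 2 statements merged into one kernel-verified Lean document; each statement's English description precedes it below -/
import Mathlib

section
/- For every integer k such that δ_1 = 9k^2 + 3k + 1 is squarefree, the trinomial f_{1,k}(x) = x^3 - 3δ_1 x + (6k+1)δ_1 is monogenic; that is, for a root θ, Z[θ] is the ring of integers of Q(θ). -/
open Polynomial

/-- A monic irreducible polynomial `f ∈ ℤ[X]` is monogenic if whenever `θ` is an algebraic
integer in a number field `K` with minimal polynomial `f` over `ℤ` and `K = ℚ(θ)`
(detected by the degree condition), then `ℤ[θ]` is the full ring of integers of `K`. -/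
def IsMonogenic (f : Polynomial ℤ) : Prop :=
  ∀ (K : Type) [Field K] [NumberField K] (θ : NumberField.RingOfIntegers K),
    minpoly ℤ θ = f → Module.finrank ℚ K = f.natDegree →
      Algebra.adjoin ℤ ({θ} : Set (NumberField.RingOfIntegers K)) = ⊤

lemma eis_step {K : Type} [Field K] [NumberField K] (α : K) (hα : IsIntegral ℤ α)
    (a b c p : ℤ) (hp : Prime p) (hfr : Module.finrank ℚ K = 3)
    (htop : Algebra.adjoin ℚ {α} = ⊤)
    (hroot : α ^ 3 + a * α ^ 2 + b * α + c = 0)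
    (ha : p ∣ a) (hb : p ∣ b) (hc : p ∣ c) (hc2 : ¬ p ^ 2 ∣ c)
    (z : K) (hz : IsIntegral ℤ z) (hpz : p • z ∈ Algebra.adjoin ℤ {α}) :
    z ∈ Algebra.adjoin ℤ {α} := by
  have hαQ : IsIntegral ℚ α := IsIntegral.of_finite ℚ α
  let B := PowerBasis.ofAdjoinEqTop hαQ htop
  have hgen : B.gen = α := PowerBasis.ofAdjoinEqTop_gen hαQ htop
  have hdegQ : (minpoly ℚ α).natDegree = 3 := by
    rw [← hfr, B.finrank]; rfl
  have hdegZ : (minpoly ℤ α).natDegree = 3 := by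
    rw [minpoly.isIntegrallyClosed_eq_field_fractions' ℚ hα,
      (minpoly.monic hα).natDegree_map] at hdegQ
    exact hdegQ
  set g : ℤ[X] := X ^ 3 + C a * X ^ 2 + C b * X + C c with hg
  have hgd : g.natDegree = 3 := by rw [hg]; compute_degree!
  have hgm : g.Monic := by rw [hg]; monicity!
  have hmin : minpoly ℤ α = g := by
    symm
    apply minpoly.IsIntegrallyClosed.unique_of_degree_le_degree_minpoly hgm
    · simpa [hg] using hroot
    · rw [degree_eq_natDegree hgm.ne_zero, degree_eq_natDegree (minpoly.ne_zero hα), hgd, hdegZ]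
  have hei : (minpoly ℤ B.gen).IsEisensteinAt (Submodule.span ℤ {p}) := by
    rw [hgen, hmin]
    refine ⟨?_, ?_, ?_⟩
    · rw [hgm.leadingCoeff]
      intro h
      exact hp.not_isUnit (isUnit_of_dvd_one (Ideal.mem_span_singleton.1 h))
    · intro n hn
      rw [hgd] at hn
      apply Ideal.mem_span_singleton.2
      interval_cases n
      · simpa [hg] using hc
      · simpa [hg, coeff_X, coeff_C, -eq_intCast] using hb
      · simpa [hg, coeff_X, coeff_C, -eq_intCast] using ha
    · intro h
      apply hc2
      have h1 : g.coeff 0 ∈ (Ideal.span {p} : Ideal ℤ) ^ 2 := h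
      rw [Ideal.span_singleton_pow] at h1
      have := Ideal.mem_span_singleton.1 h1
      simpa [hg] using this
  have := mem_adjoin_of_smul_prime_smul_of_minpoly_isEisensteinAt (B := B) hp
    (by rw [hgen]; exact hα) hz (by rw [hgen]; exact hpz) hei
  rwa [hgen] at this

lemma strip {K : Type} [Field K] [NumberField K] (A : Subalgebra ℤ K) (n : ℕ) :
    n ≠ 0 → (∀ p : ℕ, p.Prime → p ∣ n → ∀ z : K, IsIntegral ℤ z → (p : ℤ) • z ∈ A → z ∈ A) →
    ∀ z : K, IsIntegral ℤ z → (n : ℤ) • z ∈ A → z ∈ A := by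
  induction n using induction_on_primes with
  | zero => intro h; exact absurd rfl h
  | one => intro _ _ z _ h; simpa using h
  | prime_mul p a hp ih =>
    intro h0 H z hz hm
    refine ih (right_ne_zero_of_mul h0) (fun q hq hqa => H q hq (hqa.mul_left p)) z hz ?_
    refine H p hp (dvd_mul_right p a) _ (hz.smul _) ?_
    rw [smul_smul]
    exact_mod_cast hm

lemma aev1 {R : Type} [CommRing R] (x : R) (A B : ℤ) :
    aeval x (X ^ 3 - C A * X + C B : ℤ[X]) = x ^ 3 - A * x + B := by
  simp

lemma aev2 {R : Type} [CommRing R] (x : R) (A B : ℤ) :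
    aeval x (derivative (X ^ 3 - C A * X + C B : ℤ[X])) = 3 * x ^ 2 - A := by
  rw [derivative_add, derivative_sub, derivative_X_pow, derivative_C_mul,
        derivative_X, derivative_C]
  have h : aeval x (3 : ℤ[X]) = (3 : R) := map_ofNat (aeval x) 3
  simp [h]

lemma aev3 {R : Type} [CommRing R] (x : R) (A B D : ℤ) :
    aeval x (C A * X ^ 2 + C B * X - C D : ℤ[X]) = A * x ^ 2 + B * x - D := by
  simp

lemma deriv_cond {K : Type} [Field K] [NumberField K] (θ : NumberField.RingOfIntegers K)
    (htop : Algebra.adjoin ℚ {algebraMap _ K θ} = ⊤) (z : NumberField.RingOfIntegers K) :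
    aeval θ (derivative (minpoly ℤ θ)) * z ∈ Algebra.adjoin ℤ {θ} := by
  have h := conductor_mul_differentIdeal ℤ ℚ K θ htop
  have h2 := Ideal.mem_span_singleton_self (aeval θ (derivative (minpoly ℤ θ)))
  rw [← h] at h2
  have h3 : aeval θ (derivative (minpoly ℤ θ)) ∈ conductor ℤ θ := Ideal.mul_le_left h2
  exact h3 z

theorem f1k_monogenic (k : ℤ) (hsf : Squarefree (9 * k ^ 2 + 3 * k + 1)) :
    IsMonogenic (X ^ 3 - C (3 * (9 * k ^ 2 + 3 * k + 1)) * X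
      + C ((6 * k + 1) * (9 * k ^ 2 + 3 * k + 1))) := by
  intro K _ _ θ hmin hfr
  obtain ⟨d, hd⟩ : ∃ d, d = 9 * k ^ 2 + 3 * k + 1 := ⟨_, rfl⟩
  rw [← hd] at hsf hmin hfr
  have hfr3 : Module.finrank ℚ K = 3 := by rw [hfr]; compute_degree!
  have hθ : IsIntegral ℤ θ := NumberField.RingOfIntegers.isIntegral θ
  set α : K := algebraMap _ K θ with hαdef
  have hα : IsIntegral ℤ α := NumberField.RingOfIntegers.isIntegral_coe θ
  have hminα : minpoly ℤ α = minpoly ℤ θ :=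
    minpoly.algebraMap_eq (NumberField.RingOfIntegers.coe_injective) θ
  have htop : Algebra.adjoin ℚ {α} = ⊤ := by
    have h1 : IntermediateField.adjoin ℚ {α} = ⊤ := by
      rw [Field.primitive_element_iff_minpoly_natDegree_eq,
        minpoly.isIntegrallyClosed_eq_field_fractions' ℚ hα,
        (minpoly.monic hα).natDegree_map, hminα, hmin, hfr]
    rw [← IntermediateField.adjoin_simple_toSubalgebra_of_isAlgebraic (IsIntegral.of_finite ℚ α).isAlgebraic, h1]
    rfl
  have hroot : θ ^ 3 - 3 * d * θ + (6 * k + 1) * d = 0 := by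
    have := minpoly.aeval ℤ θ
    rw [hmin] at this
    rw [aev1] at this
    push_cast at this
    exact this
  have hrootα : α ^ 3 - 3 * d * α + (6 * k + 1) * d = 0 := by
    have := minpoly.aeval ℤ α
    rw [hminα, hmin] at this
    rw [aev1] at this
    push_cast at this
    exact this
  -- f'(θ) in conductor
  have hcond : ∀ z : NumberField.RingOfIntegers K, (9 * d) • z ∈ Algebra.adjoin ℤ {θ} := by
    intro z
    have h2 := deriv_cond θ htop z
    have h3 : (2 * θ ^ 2 + (6 * k + 1) * θ - 4 * d) ∈ Algebra.adjoin ℤ {θ} := by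
      have : aeval θ (C 2 * X ^ 2 + C (6 * k + 1) * X - C (4 * d) : ℤ[X]) ∈ Algebra.adjoin ℤ {θ} :=
        aeval_mem_adjoin_singleton ℤ θ
      rw [aev3] at this
      push_cast at this
      exact this
    have h4 := mul_mem h3 h2
    have h5 : aeval θ (derivative (minpoly ℤ θ)) = 3 * θ ^ 2 - 3 * d := by
      rw [hmin]
      rw [aev2]
      push_cast
      rfl
    rw [h5] at h4
    convert h4 using 1
    rw [zsmul_eq_mul]
    have hdθ : (d : NumberField.RingOfIntegers K) = 9 * k ^ 2 + 3 * k + 1 := by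
      rw [hd]; push_cast; ring
    push_cast
    linear_combination (- z * 3 * (2 * θ + (6 * k + 1))) * hroot - 12 * d * z * hdθ
  have hd0 : d ≠ 0 := hsf.ne_zero
  have hpos : ∀ p : ℕ, p.Prime → p ∣ (9 * d).natAbs → ∀ z : K, IsIntegral ℤ z →
      (p : ℤ) • z ∈ Algebra.adjoin ℤ {α} → z ∈ Algebra.adjoin ℤ {α} := by
    intro p hp hpd z hz hpz
    have hpZ : Prime (p : ℤ) := Nat.prime_iff_prime_int.1 hp
    have hpd' : (p : ℤ) ∣ 9 * d := Int.natCast_dvd.2 hpd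
    by_cases h3 : p = 3
    · subst h3
      have hadj : ∀ (R : Type) [CommRing R] [Algebra R K],
          Algebra.adjoin R {α + 1} = Algebra.adjoin R {α} := by
        intro R _ _
        apply le_antisymm <;> apply Algebra.adjoin_le <;> rw [Set.singleton_subset_iff]
        · exact add_mem (Algebra.subset_adjoin rfl) (one_mem _)
        · have : (α + 1) - 1 ∈ Algebra.adjoin R {α + 1} :=
            sub_mem (Algebra.subset_adjoin rfl) (one_mem _)
          simpa using this
      rw [← hadj ℤ]
      refine eis_step (α + 1) (hα.add isIntegral_one) (-3) (3 - 3 * d)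
        (-1 + 3 * d + (6 * k + 1) * d) 3 (by exact_mod_cast hpZ) hfr3 (by rw [hadj, htop])
        ?_ (by norm_num) ⟨1 - d, by ring⟩ ?_ ?_ z hz (by rw [hadj]; exact_mod_cast hpz)
      · push_cast
        linear_combination hrootα
      · rw [hd]; exact ⟨18 * k ^ 3 + 18 * k ^ 2 + 6 * k + 1, by ring⟩
      · rw [hd]
        rintro ⟨c, hc⟩
        ring_nf at hc
        omega
    · have hpd1 : (p : ℤ) ∣ d := by
        rcases hpZ.dvd_or_dvd hpd' with h | h
        · exfalso
          have h9 : (p : ℤ) ∣ 3 ^ 2 := by simpa using h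
          have := hpZ.dvd_of_dvd_pow h9
          have : p ∣ 3 := by exact_mod_cast this
          exact h3 ((Nat.prime_dvd_prime_iff_eq hp Nat.prime_three).1 this)
        · exact h
      refine eis_step α hα 0 (-(3 * d)) ((6 * k + 1) * d) p hpZ hfr3 htop
        ?_ (dvd_zero _) (hpd1.mul_left 3).neg_right (hpd1.mul_left _) ?_ z hz hpz
      · push_cast
        linear_combination hrootα
      · rintro ⟨c, hc⟩
        obtain ⟨e, he⟩ := hpd1
        have h6 : (6 * k + 1) * e = p * c := by
          apply mul_left_cancel₀ hpZ.ne_zero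
          rw [he] at hc
          linear_combination hc
        rcases hpZ.dvd_or_dvd (Dvd.intro _ h6.symm) with h | h
        · have : (p : ℤ) ∣ 3 := by
            have e3 : (3 : ℤ) = 4 * d - (6 * k + 1) * (6 * k + 1) := by rw [hd]; ring
            rw [e3]
            exact dvd_sub (he ▸ (dvd_mul_right _ _).mul_left 4) (h.mul_left _)
          have : p ∣ 3 := by exact_mod_cast this
          exact h3 ((Nat.prime_dvd_prime_iff_eq hp Nat.prime_three).1 this)
        · obtain ⟨e', he'⟩ := h
          exact hpZ.not_isUnit (hsf p ⟨e', by rw [he, he']; ring⟩)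
  have hmap : (Algebra.adjoin ℤ {θ}).map
      (IsScalarTower.toAlgHom ℤ (NumberField.RingOfIntegers K) K) = Algebra.adjoin ℤ {α} := by
    rw [AlgHom.map_adjoin_singleton]; rfl
  rw [eq_top_iff]
  intro z _
  have hzK : (algebraMap _ K z : K) ∈ Algebra.adjoin ℤ {α} := by
    refine strip _ (9 * d).natAbs (by simpa using hd0) hpos _
      (NumberField.RingOfIntegers.isIntegral_coe z) ?_
    have h9 : (9 * d) • (algebraMap _ K z : K) ∈ Algebra.adjoin ℤ {α} := by
      rw [← hmap]
      exact ⟨_, hcond z, map_zsmul _ _ _⟩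
    rcases Int.natAbs_eq (9 * d) with h | h
    · rw [← h]; exact h9
    · have : ((9 * d).natAbs : ℤ) = - (9 * d) := by omega
      rw [this, neg_smul]
      exact neg_mem h9
  rw [← hmap] at hzK
  obtain ⟨w, hw, hwz⟩ := hzK
  have : w = z := NumberField.RingOfIntegers.coe_injective hwz
  exact this ▸ hw
end

section
/- Each of the four trinomials x^3 + 3x^2 - 3, x^3 - 3x^2 + 3, x^3 - 3x^2 + 1, and x^3 + 3x^2 - 1 is irreducible over Q, has square discriminant (hence cyclic Galois group C_3), and is monogenic. -/
open Polynomial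

/-- The polynomial `x^3 + A x^2 + B` is irreducible over `ℚ`, has square discriminant
`-B(4A^3 + 27B)` (hence cyclic Galois group `C₃`), and is monogenic. -/
def GoodTrinomial (A B : ℤ) : Prop :=
  Irreducible (X ^ 3 + C (A : ℚ) * X ^ 2 + C (B : ℚ)) ∧
  (∃ n : ℤ, -B * (4 * A ^ 3 + 27 * B) = n ^ 2) ∧
  IsCyclic (X ^ 3 + C (A : ℚ) * X ^ 2 + C (B : ℚ)).Gal ∧
  Nat.card (X ^ 3 + C (A : ℚ) * X ^ 2 + C (B : ℚ)).Gal = 3 ∧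
  IsMonogenic (X ^ 3 + C A * X ^ 2 + C B)

lemma zmod_aux : ∀ x : ZMod 2, ¬ x ^ 3 + x ^ 2 + 1 = 0 := by decide

lemma mono_aux (a b c q0 q1 q2 : ℤ) (ha : 3 ∣ a) (hb : 3 ∣ b) (hc : 3 ∣ c) (hc' : ¬ 9 ∣ c)
    (K : Type) [Field K] [NumberField K] (η : K) (h : η ^ 3 + a * η ^ 2 + b * η + c = 0)
    (hK : Module.finrank ℚ K = 3)
    (hq : (3 * η ^ 2 + 2 * a * η + b) * (q0 + q1 * η + q2 * η ^ 2) = 81)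
    (z : K) (hz : IsIntegral ℤ z) : z ∈ Algebra.adjoin ℤ ({η} : Set K) := by
  set g : ℤ[X] := X ^ 3 + C a * X ^ 2 + C b * X + C c with hg
  have hmon : g.Monic := by rw [hg]; monicity!
  have hdeg : g.natDegree = 3 := by rw [hg]; compute_degree!
  have hp3 : Prime (3 : ℤ) := Int.prime_three
  have hprime : (Ideal.span {(3:ℤ)}).IsPrime := (Ideal.span_singleton_prime (by norm_num)).2 hp3
  have hei : g.IsEisensteinAt (Ideal.span {(3:ℤ)}) := by
    refine ⟨?_, ?_, ?_⟩
    · rw [hmon.leadingCoeff]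
      exact fun h => hprime.ne_top ((Ideal.eq_top_iff_one _).2 h)
    · intro n hn
      rw [hdeg] at hn
      rw [Ideal.mem_span_singleton]
      interval_cases n <;> simp [hg, coeff_X, coeff_C, coeff_X_pow, -eq_intCast, -algebraMap_int_eq] <;> assumption
    · rw [Ideal.span_singleton_pow, Ideal.mem_span_singleton]
      simpa [hg] using hc'
  have hirr : Irreducible g := hei.irreducible hprime hmon.isPrimitive (by omega)
  have hroot : aeval η g = 0 := by simpa [hg] using h
  have hint : IsIntegral ℤ η := ⟨g, hmon, hroot⟩
  have hmp : minpoly ℤ η = g := by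
    apply eq_of_monic_of_associated (minpoly.monic hint) hmon
    have := minpoly.isIntegrallyClosed_dvd hint hroot
    exact (minpoly.irreducible hint).associated_of_dvd hirr this
  have hmpQ : minpoly ℚ η = g.map (algebraMap ℤ ℚ) := by
    rw [minpoly.isIntegrallyClosed_eq_field_fractions' ℚ hint, hmp]
  have htop : IntermediateField.adjoin ℚ {η} = ⊤ := by
    rw [Field.primitive_element_iff_minpoly_natDegree_eq, hmpQ, hmon.natDegree_map, hdeg, hK]
  have hintQ : IsIntegral ℚ η := hint.tower_top
  let B : PowerBasis ℚ K := PowerBasis.ofAdjoinEqTop hintQ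
    (Algebra.adjoin_eq_top_of_primitive_element hintQ.isAlgebraic htop)
  have hB : B.gen = η := by simp [B]
  have hdisc := Algebra.discr_mul_isIntegral_mem_adjoin (R := ℤ) ℚ (B := B) (by rw [hB]; exact hint) hz
  rw [Algebra.discr_powerBasis_eq_norm, hB, hmpQ] at hdisc
  have hder : aeval η (derivative (g.map (algebraMap ℤ ℚ))) = 3 * η ^ 2 + 2 * a * η + b := by
    simp [hg]
    ring
  rw [hder] at hdisc
  have haev : ∀ p : ℤ[X], IsIntegral ℤ (aeval η p) := fun p =>
    IsIntegral.of_mem_of_fg _ hint.fg_adjoin_singleton _ (aeval_mem_adjoin_singleton ℤ η)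
  have hi1 : IsIntegral ℤ (Algebra.norm ℚ (3 * η ^ 2 + 2 * a * η + b)) := by
    apply Algebra.isIntegral_norm
    rw [show 3 * η ^ 2 + 2 * a * η + b = aeval η (C 3 * X ^ 2 + C (2 * a) * X + C b : ℤ[X]) by
      simp only [map_add, map_mul, map_pow, aeval_X, aeval_C]; simp]
    exact haev _
  have hi2 : IsIntegral ℤ (Algebra.norm ℚ (q0 + q1 * η + q2 * η ^ 2)) := by
    apply Algebra.isIntegral_norm
    rw [show q0 + q1 * η + q2 * η ^ 2 = aeval η (C q0 + C q1 * X + C q2 * X ^ 2 : ℤ[X]) by simp]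
    exact haev _
  obtain ⟨u, hu⟩ := IsIntegrallyClosed.isIntegral_iff.1 hi1
  obtain ⟨v, hv⟩ := IsIntegrallyClosed.isIntegral_iff.1 hi2
  have huv : u * v = 3 ^ 12 := by
    have h1 := congrArg (Algebra.norm ℚ) hq
    rw [map_mul, ← hu, ← hv, show (81 : K) = algebraMap ℚ K 81 by simp,
      Algebra.norm_algebraMap, hK] at h1
    simp only [eq_intCast] at h1
    have : (u * v : ℚ) = 3 ^ 12 := by rw [h1]; norm_num
    exact_mod_cast this
  obtain ⟨i, -, hi⟩ := (dvd_prime_pow hp3 12).1 ⟨v, huv.symm⟩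
  have key : (3 : ℤ) ^ i • z ∈ Algebra.adjoin ℤ ({η} : Set K) := by
    obtain ⟨w, hw⟩ := hi
    have : (3 : ℤ) ^ i • z = ((w : ℤ) * (-1) ^ (Module.finrank ℚ K * (Module.finrank ℚ K - 1) / 2)) •
       (((-1) ^ (Module.finrank ℚ K * (Module.finrank ℚ K - 1) / 2) * Algebra.norm ℚ (3 * η ^ 2 + 2 * a * η + b)) • z) := by
      rw [← hw, ← hu]
      simp only [zsmul_eq_mul, Algebra.smul_def]
      push_cast
      simp only [map_mul, map_pow, map_neg, map_one, eq_intCast, map_intCast]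
      rcases neg_one_pow_eq_or K (Module.finrank ℚ K * (Module.finrank ℚ K - 1) / 2) with h | h <;> rw [h] <;> ring
    rw [this]
    exact Subalgebra.smul_mem _ hdisc _
  have := mem_adjoin_of_smul_prime_pow_smul_of_minpoly_isEisensteinAt (K := ℚ) (B := B) hp3
    (by rw [hB]; exact hint) hz (by rw [hB]; exact key) (by rw [hB, hmp]; exact hei)
  rwa [hB] at this

lemma mono_aux2 (A B a b c q0 q1 q2 s : ℤ) (ha : 3 ∣ a) (hb : 3 ∣ b) (hc : 3 ∣ c) (hc' : ¬ 9 ∣ c)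
    (h : ∀ (K : Type) [Field K] (θ : K), θ ^ 3 + A * θ ^ 2 + B = 0 →
      (θ + s) ^ 3 + a * (θ + s) ^ 2 + b * (θ + s) + c = 0)
    (hq : ∀ (K : Type) [Field K] (η : K), η ^ 3 + a * η ^ 2 + b * η + c = 0 → 
      (3 * η ^ 2 + 2 * a * η + b) * (q0 + q1 * η + q2 * η ^ 2) = 81) :
    IsMonogenic (X ^ 3 + C A * X ^ 2 + C B) := by
  intro K _ _ θ hθ hK
  have hd : (X ^ 3 + C A * X ^ 2 + C B : ℤ[X]).natDegree = 3 := by compute_degree!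
  rw [hd] at hK
  have hr : (θ : K) ^ 3 + A * (θ : K) ^ 2 + B = 0 := by
    have := minpoly.aeval ℤ θ
    rw [hθ] at this
    have := congrArg (algebraMap (NumberField.RingOfIntegers K) K) this
    simpa using this
  have h1 := h K θ hr
  rw [Algebra.eq_top_iff]
  intro z
  have h2 := mono_aux a b c q0 q1 q2 ha hb hc hc' K _ h1 hK (hq K _ h1) (z : K) z.isIntegral_coe
  rw [Algebra.adjoin_singleton_eq_range_aeval] at h2 ⊢
  obtain ⟨p, hp⟩ := h2
  refine ⟨p.comp (X + C s), ?_⟩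
  apply NumberField.RingOfIntegers.ext
  rw [← hp]
  simp only [AlgHom.toRingHom_eq_coe, RingHom.coe_coe]
  have e : ((aeval θ (p.comp (X + C s)) : NumberField.RingOfIntegers K) : K) =
     aeval (θ : K) (p.comp (X + C s)) := (aeval_algebraMap_apply K θ _).symm
  rw [e, aeval_comp]
  simp

lemma finrank_aux {k : Type} [Field k] (f : k[X]) (hirr : Irreducible f)
    (hs : (f.map (AdjoinRoot.of f)).Splits) :
    Module.finrank k f.SplittingField = f.natDegree := by
  haveI : Fact (Irreducible f) := ⟨hirr⟩
  haveI : IsSplittingField k (AdjoinRoot f) f := by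
    constructor
    · exact hs
    · rw [eq_top_iff, ← AdjoinRoot.adjoinRoot_eq_top]
      apply Algebra.adjoin_mono
      rw [Set.singleton_subset_iff, mem_rootSet]
      exact ⟨hirr.ne_zero, by simp⟩
  rw [← (IsSplittingField.algEquiv (AdjoinRoot f) f).toLinearEquiv.finrank_eq,
    (AdjoinRoot.powerBasis hirr.ne_zero).finrank, AdjoinRoot.powerBasis_dim]

lemma good_aux (A B r0 r1 r2 a b c q0 q1 q2 s n : ℤ) (hA : Odd A) (hB : Odd B)
    (hn : -B * (4 * A ^ 3 + 27 * B) = n ^ 2)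
    (hr : ∀ (K : Type) [Field K] (θ r : K), θ ^ 3 + A * θ ^ 2 + B = 0 → r = r0 + r1 * θ + r2 * θ ^ 2 →
      θ * r + (θ + r) * (-A - θ - r) = 0 ∧ θ * r * (-A - θ - r) = - B)
    (ha : 3 ∣ a) (hb : 3 ∣ b) (hc : 3 ∣ c) (hc' : ¬ 9 ∣ c)
    (h : ∀ (K : Type) [Field K] (θ : K), θ ^ 3 + A * θ ^ 2 + B = 0 →
      (θ + s) ^ 3 + a * (θ + s) ^ 2 + b * (θ + s) + c = 0)
    (hq : ∀ (K : Type) [Field K] (η : K), η ^ 3 + a * η ^ 2 + b * η + c = 0 → 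
      (3 * η ^ 2 + 2 * a * η + b) * (q0 + q1 * η + q2 * η ^ 2) = 81) :
    GoodTrinomial A B := by
  have hirr : Irreducible (X ^ 3 + C (A : ℚ) * X ^ 2 + C (B : ℚ)) := by
    have hm : (X ^ 3 + C A * X ^ 2 + C B : ℤ[X]).Monic := by monicity!
    have h1 : Irreducible (X ^ 3 + C A * X ^ 2 + C B : ℤ[X]) := by
      haveI : Fact (Nat.Prime 2) := ⟨Nat.prime_two⟩
      apply Monic.irreducible_of_irreducible_map (Int.castRingHom (ZMod 2)) _ hm
      have hA' : (A : ZMod 2) = 1 := by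
        obtain ⟨k, rfl⟩ := hA
        push_cast; rw [show (2 : ZMod 2) = 0 from rfl]; simp
      have hB' : (B : ZMod 2) = 1 := by
        obtain ⟨k, rfl⟩ := hB
        push_cast; rw [show (2 : ZMod 2) = 0 from rfl]; simp
      have : (X ^ 3 + C A * X ^ 2 + C B : ℤ[X]).map (Int.castRingHom (ZMod 2)) =
          X ^ 3 + X ^ 2 + C 1 := by
        simp [hA', hB', -map_intCast]
        simp [hA', hB', ← map_intCast (C : ZMod 2 →+* (ZMod 2)[X])]
      rw [this]
      apply irreducible_of_degree_le_three_of_not_isRoot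
      · have : (X ^ 3 + X ^ 2 + C 1 : (ZMod 2)[X]).natDegree = 3 := by compute_degree!
        rw [this]; decide
      · intro x
        simp only [IsRoot, eval_add, eval_pow, eval_X, eval_C]
        exact zmod_aux x
    have := (hm.irreducible_iff_irreducible_map_fraction_map (K := ℚ)).1 h1
    simpa using this
  have hcard : Nat.card (X ^ 3 + C (A : ℚ) * X ^ 2 + C (B : ℚ)).Gal = 3 := by
    rw [Gal.card_of_separable hirr.separable]
    set f : ℚ[X] := X ^ 3 + C (A : ℚ) * X ^ 2 + C (B : ℚ) with hf
    have hd : f.natDegree = 3 := by rw [hf]; compute_degree!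
    haveI : Fact (Irreducible f) := ⟨hirr⟩
    have hroot : (AdjoinRoot.root f) ^ 3 + A * (AdjoinRoot.root f) ^ 2 + B = 0 := by
      have h0 : f.eval₂ (AdjoinRoot.of f) (AdjoinRoot.root f) = 0 := AdjoinRoot.eval₂_root f
      have h1 : f.eval₂ (AdjoinRoot.of f) (AdjoinRoot.root f) =
          (AdjoinRoot.root f) ^ 3 + A * (AdjoinRoot.root f) ^ 2 + B := by
        conv_lhs => rw [show eval₂ (AdjoinRoot.of f) (AdjoinRoot.root f) f =
          eval₂ (AdjoinRoot.of f) (AdjoinRoot.root f) (X ^ 3 + C (A : ℚ) * X ^ 2 + C (B : ℚ)) from rfl]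
        simp only [eval₂_add, eval₂_mul, eval₂_pow, eval₂_X, eval₂_C]
        simp only [map_intCast]
      rw [← h1, h0]
    set θ := AdjoinRoot.root f with hθ
    obtain ⟨e2, e3⟩ := hr (AdjoinRoot f) θ _ hroot rfl
    set r : AdjoinRoot f := r0 + r1 * θ + r2 * θ ^ 2
    have hfac : f.map (AdjoinRoot.of f) = (X - C θ) * (X - C r) * (X - C (-A - θ - r)) := by
      have h2 := congrArg C e2
      have h3 := congrArg C e3
      have : f.map (AdjoinRoot.of f) = X ^ 3 + C (A : AdjoinRoot f) * X ^ 2 + C (B : AdjoinRoot f) := by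
        simp [hf]
      rw [this]
      simp only [map_add, map_mul, map_sub, map_neg, map_zero] at h2 h3 ⊢
      linear_combination (-X) * h2 + h3
    rw [finrank_aux f hirr ?_, hd]
    rw [hfac]
    exact ((Splits.X_sub_C _).mul (Splits.X_sub_C _)).mul (Splits.X_sub_C _)
  refine ⟨hirr, ⟨n, hn⟩, ?_, hcard, mono_aux2 A B a b c q0 q1 q2 s ha hb hc hc' h hq⟩
  haveI : Fact (Nat.Prime 3) := ⟨Nat.prime_three⟩
  exact isCyclic_of_prime_card hcard

theorem four_trinomials_good :
    GoodTrinomial 3 (-3) ∧ GoodTrinomial (-3) 3 ∧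
    GoodTrinomial (-3) 1 ∧ GoodTrinomial 3 (-1) := by
  refine ⟨?_, ?_, ?_, ?_⟩
  · refine good_aux 3 (-3) 0 (-2) (-1) 3 0 (-3) (-27) 27 18 0 9 (by decide) (by decide) (by norm_num)
      ?_ (by norm_num) (by norm_num) (by norm_num) (by norm_num) ?_ ?_
    · rintro K _ θ r h rfl
      push_cast at h ⊢
      exact ⟨by linear_combination (-θ) * h, by linear_combination (1 - θ ^ 2) * h⟩
    · intro K _ θ h
      push_cast at h ⊢
      linear_combination h
    · intro K _ η h
      push_cast at h ⊢
      linear_combination (27 + 54 * η) * h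
  · refine good_aux (-3) 3 0 (-2) 1 (-3) 0 3 (-27) (-27) 18 0 9 (by decide) (by decide) (by norm_num)
      ?_ (by norm_num) (by norm_num) (by norm_num) (by norm_num) ?_ ?_
    · rintro K _ θ r h rfl
      push_cast at h ⊢
      exact ⟨by linear_combination (-θ) * h, by linear_combination (1 - θ ^ 2) * h⟩
    · intro K _ θ h
      push_cast at h ⊢
      linear_combination h
    · intro K _ η h
      push_cast at h ⊢
      linear_combination (-27 + 54 * η) * h
  · refine good_aux (-3) 1 2 2 (-1) (-6) 9 (-3) 54 (-81) 18 1 9 (by decide) (by decide) (by norm_num)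
      ?_ (by norm_num) (by norm_num) (by norm_num) (by norm_num) ?_ ?_
    · rintro K _ θ r h rfl
      push_cast at h ⊢
      exact ⟨by linear_combination (2 - θ) * h, by linear_combination (1 + 2 * θ - θ ^ 2) * h⟩
    · intro K _ θ h
      push_cast at h ⊢
      linear_combination h
    · intro K _ η h
      push_cast at h ⊢
      linear_combination (-135 + 54 * η) * h
  · refine good_aux 3 (-1) (-2) 2 1 6 9 3 54 81 18 (-1) 9 (by decide) (by decide) (by norm_num)
      ?_ (by norm_num) (by norm_num) (by norm_num) (by norm_num) ?_ ?_
    · rintro K _ θ r h rfl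
      push_cast at h ⊢
      exact ⟨by linear_combination (-2 - θ) * h, by linear_combination (1 - 2 * θ - θ ^ 2) * h⟩
    · intro K _ θ h
      push_cast at h ⊢
      linear_combination h
    · intro K _ η h
      push_cast at h ⊢
      linear_combination (135 + 54 * η) * h
end
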